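/- Let Q be a union of conjunctive queries with negation and inequalities (UCQ¬,≠) and ρ a distribution policy. If Q is not parallel-sound under ρ, then there is an instance J of facts over the universe of ρ with |adom(J)| ≤ varmax(Q) such that Q is not parallel-sound on J under ρ. -/

import Mathlib

/-- An atom `R(x₁,…,x_k)`: a relation name together with a tuple of variables. -/
structure Atom (R V : Type) where
  rel : R
  args : List V
deriving DecidableEq

/-- A fact `R(t)`: a relation name together with a tuple of data values. -/
structure DBFact (R D : Type) where
  rel : R
  args : List D
deriving DecidableEq

/-- Applying a valuation to an atom yields a fact. -/
def Atom.app {R V D : Type} (f : V → D) (a : Atom R V) : DBFact R D :=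
  ⟨a.rel, a.args.map f⟩

/-- The variables occurring in an atom. -/
def Atom.vars {R V : Type} (a : Atom R V) : Set V := {v | v ∈ a.args}

/-- A conjunctive query with negation and inequalities (CQ¬,≠): a head atom,
finite sets of positive and negated body atoms, and a finite set of
inequalities between variables. -/
structure CQ (R V : Type) where
  head : Atom R V
  pos : Finset (Atom R V)
  neg : Finset (Atom R V)
  ineq : Finset (V × V)

namespace CQ

variable {R V D : Type}

/-- The variables occurring in a query. -/
def vars (Q : CQ R V) : Set V :=
  Q.head.vars ∪ (⋃ a ∈ (↑Q.pos : Set (Atom R V)), a.vars) ∪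
    (⋃ a ∈ (↑Q.neg : Set (Atom R V)), a.vars) ∪
    (⋃ p ∈ (↑Q.ineq : Set (V × V)), {p.1, p.2})

/-- Safety: every head variable and every variable of a negated atom occurs in
some positive atom. -/
def safe (Q : CQ R V) : Prop :=
  (∀ v ∈ Q.head.vars, ∃ a ∈ Q.pos, v ∈ a.args) ∧
  (∀ a ∈ Q.neg, ∀ v ∈ a.args, ∃ b ∈ Q.pos, v ∈ b.args)

/-- A query is full if every one of its variables occurs in its head atom. -/
def isFull (Q : CQ R V) : Prop := ∀ v ∈ Q.vars, v ∈ Q.head.args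

/-- The facts required by a valuation `f`: `f(pos(Q))`. -/
def posFacts (Q : CQ R V) (f : V → D) : Set (DBFact R D) :=
  Atom.app f '' (↑Q.pos : Set (Atom R V))

/-- The facts prohibited by a valuation `f`: `f(neg(Q))`. -/
def negFacts (Q : CQ R V) (f : V → D) : Set (DBFact R D) :=
  Atom.app f '' (↑Q.neg : Set (Atom R V))

/-- `f` is a valuation for `Q`: required and prohibited facts are disjoint and
all inequalities are respected. -/
def isVal (Q : CQ R V) (f : V → D) : Prop :=
  Q.posFacts f ∩ Q.negFacts f = ∅ ∧
  ∀ p ∈ Q.ineq, f p.1 ≠ f p.2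

/-- `f` satisfies `Q` on `I`: all required facts are in `I` and no prohibited
fact is in `I`. -/
def sat (Q : CQ R V) (f : V → D) (I : Set (DBFact R D)) : Prop :=
  Q.posFacts f ⊆ I ∧ Q.negFacts f ∩ I = ∅

/-- `Q(I)`: the set of facts derived on `I` by valuations satisfying `Q`. -/
def eval (Q : CQ R V) (I : Set (DBFact R D)) : Set (DBFact R D) :=
  {fc | ∃ f : V → D, Q.isVal f ∧ Q.sat f I ∧ Atom.app f Q.head = fc}

end CQ

/-- A union of conjunctive queries (with negation and inequalities): a finite,
nonempty family of CQ¬,≠s. -/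
structure UCQ (R V : Type) where
  n : ℕ
  npos : 0 < n
  disj : Fin n → CQ R V

namespace UCQ

variable {R V D : Type}

/-- Well-formedness of a UCQ: every disjunct is safe, all disjuncts have the
same head relation, and distinct disjuncts have disjoint variable sets. -/
def wf (Q : UCQ R V) : Prop :=
  (∀ i, (Q.disj i).safe) ∧
  (∀ i j, (Q.disj i).head.rel = (Q.disj j).head.rel) ∧
  (∀ i j, i ≠ j → Disjoint (Q.disj i).vars (Q.disj j).vars)

/-- `Q(I) = ⋃ᵢ Qᵢ(I)`. -/
def eval (Q : UCQ R V) (I : Set (DBFact R D)) : Set (DBFact R D) :=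
  ⋃ i, (Q.disj i).eval I

/-- The maximum number of variables of any disjunct. -/
noncomputable def varmax (Q : UCQ R V) : ℕ :=
  Finset.univ.sup fun i => ((Q.disj i).vars).ncard

end UCQ

/-- The values of the fact all belong to `U`. -/
def DBFact.valsIn {R D : Type} (fc : DBFact R D) (U : Set D) : Prop :=
  ∀ d ∈ fc.args, d ∈ U

/-- The active domain of an instance: all data values occurring in it. -/
def adom {R D : Type} (I : Set (DBFact R D)) : Set D :=
  {d | ∃ fc ∈ I, d ∈ fc.args}

/-- A distribution policy over network (node type) `K`: a universe `U` of data
values and, for each node, the set of facts (with values from `U`) it is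
responsible for. -/
structure Policy (R D K : Type) where
  U : Set D
  rfacts : K → Set (DBFact R D)
  rfacts_vals : ∀ κ, ∀ fc ∈ rfacts κ, fc.valsIn U

namespace Policy
variable {R D K : Type}
/-- The local instance at node `κ`. -/
def dist (ρ : Policy R D K) (I : Set (DBFact R D)) (κ : K) : Set (DBFact R D) :=
  I ∩ ρ.rfacts κ
end Policy

/-- `I` is an instance (finite set of facts) with values from `U`. -/
def instOver {R D : Type} (I : Set (DBFact R D)) (U : Set D) : Prop :=
  I.Finite ∧ ∀ fc ∈ I, fc.valsIn U

section Parallel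
variable {R D K : Type}

/-- `q` is parallel-sound on `I` under `ρ`. -/
def parSoundOn (q : Set (DBFact R D) → Set (DBFact R D)) (ρ : Policy R D K)
    (I : Set (DBFact R D)) : Prop :=
  (⋃ κ : K, q (ρ.dist I κ)) ⊆ q I

/-- `q` is parallel-complete on `I` under `ρ`. -/
def parCompleteOn (q : Set (DBFact R D) → Set (DBFact R D)) (ρ : Policy R D K)
    (I : Set (DBFact R D)) : Prop :=
  q I ⊆ ⋃ κ : K, q (ρ.dist I κ)

/-- `q` is parallel-correct on `I` under `ρ`. -/
def parCorrectOn (q : Set (DBFact R D) → Set (DBFact R D)) (ρ : Policy R D K)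
    (I : Set (DBFact R D)) : Prop :=
  q I = ⋃ κ : K, q (ρ.dist I κ)

/-- `q` is parallel-sound under `ρ`: sound on every instance with values from
the universe of `ρ`. -/
def parSound (q : Set (DBFact R D) → Set (DBFact R D)) (ρ : Policy R D K) : Prop :=
  ∀ I : Set (DBFact R D), instOver I ρ.U → parSoundOn q ρ I

/-- `q` is parallel-complete under `ρ`. -/
def parComplete (q : Set (DBFact R D) → Set (DBFact R D)) (ρ : Policy R D K) : Prop :=
  ∀ I : Set (DBFact R D), instOver I ρ.U → parCompleteOn q ρ I

/-- `q` is parallel-correct under `ρ`. -/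
def parCorrect (q : Set (DBFact R D) → Set (DBFact R D)) (ρ : Policy R D K) : Prop :=
  ∀ I : Set (DBFact R D), instOver I ρ.U → parCorrectOn q ρ I

end Parallel

theorem Atom.app_valsIn {R V D : Type} {f : V → D} {a : Atom R V} {A : Set D} :
    (a.app f).valsIn A ↔ ∀ v ∈ a.args, f v ∈ A := by
  simp [DBFact.valsIn, Atom.app]

theorem CQ.vars_finite {R V : Type} (Q : CQ R V) : Q.vars.Finite := by
  have hatom (a : Atom R V) : a.vars.Finite := a.args.finite_toSet
  refine (((hatom _).union ?_).union ?_).union ?_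
  · exact Q.pos.finite_toSet.biUnion fun a _ => hatom a
  · exact Q.neg.finite_toSet.biUnion fun a _ => hatom a
  · exact Q.ineq.finite_toSet.biUnion fun p _ => Set.toFinite _

/-- The facts required by `f` only use values assigned to variables of the query. -/
theorem CQ.valsIn_of_mem_posFacts {R V D : Type} {Q : CQ R V} {f : V → D} {fc : DBFact R D}
    (h : fc ∈ Q.posFacts f) : fc.valsIn (f '' Q.vars) := by
  obtain ⟨a, ha, rfl⟩ := h
  refine Atom.app_valsIn.2 fun v hv => ⟨v, ?_, rfl⟩
  exact Or.inl (Or.inl (Or.inr (Set.mem_biUnion ha hv)))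

/-- In a safe query, the prohibited facts only use values of the required facts. -/
theorem CQ.safe.negFacts_valsIn {R V D : Type} {Q : CQ R V} (hQ : Q.safe) {f : V → D} {A : Set D}
    (hpos : ∀ fc ∈ Q.posFacts f, fc.valsIn A) : ∀ fc ∈ Q.negFacts f, fc.valsIn A := by
  rintro _ ⟨a, ha, rfl⟩
  refine Atom.app_valsIn.2 fun v hv => ?_
  obtain ⟨b, hb, hvb⟩ := hQ.2 a ha v hv
  exact Atom.app_valsIn.1 (hpos _ ⟨b, hb, rfl⟩) v hvb

/-- A safe query derives on the restriction of `I` to the values in `A` only facts that it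
derives on `I`. -/
theorem CQ.safe.eval_restrict_subset {R V D : Type} {Q : CQ R V} (hQ : Q.safe)
    (I : Set (DBFact R D)) (A : Set D) :
    Q.eval {fc ∈ I | fc.valsIn A} ⊆ Q.eval I := by
  rintro _ ⟨g, hg, ⟨hpos, hneg⟩, rfl⟩
  refine ⟨g, hg, ⟨fun fc hfc => (hpos hfc).1, ?_⟩, rfl⟩
  rw [Set.eq_empty_iff_forall_notMem] at hneg ⊢
  exact fun fc hfc => hneg fc
    ⟨hfc.1, hfc.2, hQ.negFacts_valsIn (fun fc h => (hpos h).2) fc hfc.1⟩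

theorem UCQ.ncard_vars_le_varmax {R V : Type} (Q : UCQ R V) (i : Fin Q.n) :
    (Q.disj i).vars.ncard ≤ Q.varmax :=
  Finset.le_sup (f := fun i => ((Q.disj i).vars).ncard) (Finset.mem_univ i)

/-- If a UCQ¬,≠ `Q` is not parallel-sound under `ρ`, then
there is a counterexample instance `J` over the universe of `ρ` with
`|adom(J)| ≤ varmax(Q)`. -/
theorem ucq_neg_parallel_sound_small_counterexample
    {R V D K : Type} [Infinite D] [Fintype K] [Nonempty K]
    (Q : UCQ R V) (hQ : Q.wf) (ρ : Policy R D K)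
    (h : ¬ parSound (fun I => Q.eval I) ρ) :
    ∃ J : Set (DBFact R D), instOver J ρ.U ∧ (adom J).ncard ≤ Q.varmax ∧
      ¬ parSoundOn (fun I => Q.eval I) ρ J := by
  simp only [parSound, parSoundOn, not_forall, Set.not_subset] at h
  obtain ⟨I, hI, fc, hfc, hfcI⟩ := h
  simp only [UCQ.eval, Set.mem_iUnion] at hfc
  obtain ⟨κ, i, f, hval, ⟨hpos, hneg⟩, rfl⟩ := hfc
  refine ⟨{fc ∈ I | fc.valsIn (f '' (Q.disj i).vars)},
    ⟨hI.1.subset fun _ h => h.1, fun fc h => hI.2 fc h.1⟩, ?_, fun hsound => hfcI ?_⟩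
  · have hfin := (Q.disj i).vars_finite
    refine (Set.ncard_le_ncard ?_ (hfin.image f)).trans
      ((Set.ncard_image_le hfin).trans (Q.ncard_vars_le_varmax i))
    rintro d ⟨fc, hfc, hd⟩
    exact hfc.2 d hd
  · refine Set.iUnion_mono (fun j => (hQ.1 j).eval_restrict_subset I _) (hsound ?_)
    refine Set.mem_iUnion.2 ⟨κ, Set.mem_iUnion.2 ⟨i, f, hval, ⟨?_, ?_⟩, rfl⟩⟩
    · exact fun fc h => ⟨⟨(hpos h).1, CQ.valsIn_of_mem_posFacts h⟩, (hpos h).2⟩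
    · rw [Set.eq_empty_iff_forall_notMem] at hneg ⊢
      exact fun fc h => hneg fc ⟨h.1, h.2.1.1, h.2.2⟩
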